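/- Let n ≥ 2 be a natural number, let M be a finite type with |M| ≤ 2^{(n·log₂ n)/2}, let enc : (Fin n → Fin n) → M and dec : M → (Fin n → Fin n) be arbitrary maps. Then, for f sampled uniformly from the functions Fin n → Fin n and j sampled uniformly from Fin n, the probability that dec(enc f)(j) ≠ f(j) is at least 1/6. -/

import Mathlib

/-- The generating function of the Hamming distances to a fixed word. -/
theorem sum_pow_hammingDist {ι α : Type*} [Fintype ι] [Fintype α] [DecidableEq ι] [DecidableEq α]
    (g : ι → α) (t : ℝ) :
    ∑ f : ι → α, t ^ hammingDist g f =
      (1 + ((Fintype.card α : ℝ) - 1) * t) ^ Fintype.card ι := by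
  have hprod (f : ι → α) : t ^ hammingDist g f = ∏ i, if g i = f i then 1 else t := by
    rw [hammingDist, Finset.prod_ite]
    simp
  have hsum (i : ι) : ∑ a : α, (if g i = a then 1 else t) =
      1 + ((Fintype.card α : ℝ) - 1) * t := by
    have h (a : α) : (if g i = a then 1 else t) = t + if g i = a then 1 - t else 0 := by
      split_ifs <;> ring
    simp only [h, Finset.sum_add_distrib, Finset.sum_ite_eq, Finset.sum_const, Finset.card_univ,
      Finset.mem_univ, if_true, nsmul_eq_mul]
    ring
  simp only [hprod]
  rw [← Fintype.piFinset_univ,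
    ← Finset.prod_univ_sum (fun _ => Finset.univ) fun i a => if g i = a then (1 : ℝ) else t]
  simp [hsum]

theorem sum_pow_hammingDist_decode_le {ι α M : Type*} [Fintype ι] [Fintype α] [Fintype M]
    [DecidableEq ι] [DecidableEq α] (enc : (ι → α) → M) (dec : M → ι → α) {t : ℝ} (ht : 0 ≤ t) :
    ∑ f, t ^ hammingDist (dec (enc f)) f ≤
      Fintype.card M * (1 + ((Fintype.card α : ℝ) - 1) * t) ^ Fintype.card ι := by
  calc ∑ f, t ^ hammingDist (dec (enc f)) f
      ≤ ∑ f, ∑ m, t ^ hammingDist (dec m) f := by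
        refine Finset.sum_le_sum fun f _ => ?_
        exact Finset.single_le_sum (f := fun m => t ^ hammingDist (dec m) f)
          (fun m _ => pow_nonneg ht _) (Finset.mem_univ (enc f))
    _ = Fintype.card M * (1 + ((Fintype.card α : ℝ) - 1) * t) ^ Fintype.card ι := by
        rw [Finset.sum_comm]
        simp [sum_pow_hammingDist]

/-- A code with few messages has a total error at least the number of misdecoded words. -/
theorem card_sub_card_le_sum_hammingDist {ι α M : Type*} [Fintype ι] [Fintype α] [Fintype M]
    [DecidableEq ι] [DecidableEq α] (enc : (ι → α) → M) (dec : M → ι → α) :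
    (Fintype.card (ι → α) : ℝ) - Fintype.card M ≤
      ∑ f, (hammingDist (dec (enc f)) f : ℝ) := by
  have h := sum_pow_hammingDist_decode_le enc dec le_rfl
  have hle : ∑ f, (1 - (0 : ℝ) ^ hammingDist (dec (enc f)) f) ≤
      ∑ f, (hammingDist (dec (enc f)) f : ℝ) := by
    refine Finset.sum_le_sum fun f _ => ?_
    rcases Nat.eq_zero_or_pos (hammingDist (dec (enc f)) f) with h0 | h0
    · simp [h0]
    · rw [zero_pow h0.ne', sub_zero]
      exact_mod_cast h0
  rw [Finset.sum_sub_distrib, Finset.sum_const, Finset.card_univ, nsmul_eq_mul, mul_one] at hle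
  rw [mul_zero, add_zero, one_pow, mul_one] at h
  linarith

/-- Jensen's inequality for `k ↦ u ^ (6 * k)`, with the mean of `d` bounded by `n / 6`. -/
theorem card_mul_pow_le_sum_pow {κ : Type*} [Fintype κ] (d : κ → ℕ) (n : ℕ) {u : ℝ}
    (hu : 0 < u) (hu1 : u ≤ 1) (hd : 6 * ∑ x, (d x : ℝ) ≤ n * Fintype.card κ) :
    Fintype.card κ * u ^ n ≤ ∑ x, (u ^ 6) ^ d x := by
  have hlog : Real.log u ≤ 0 := Real.log_nonpos hu.le hu1
  have hexp (k : ℕ) : u ^ k = Real.exp (k * Real.log u) := by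
    rw [Real.exp_nat_mul, Real.exp_log hu]
  have htangent (x : κ) : u ^ n * (1 + Real.log u * (6 * d x - n)) ≤ (u ^ 6) ^ d x := by
    have h := Real.add_one_le_exp (Real.log u * (6 * d x - n))
    calc u ^ n * (1 + Real.log u * (6 * d x - n))
        ≤ u ^ n * Real.exp (Real.log u * (6 * d x - n)) := by gcongr; linarith
      _ = (u ^ 6) ^ d x := by
        rw [← pow_mul, hexp, hexp, ← Real.exp_add]
        congr 1
        push_cast
        ring
  have hsum := Finset.sum_le_sum fun x (_ : x ∈ Finset.univ) => htangent x
  rw [← Finset.mul_sum, Finset.sum_add_distrib, ← Finset.mul_sum, Finset.sum_sub_distrib,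
    ← Finset.mul_sum, Finset.sum_const, Finset.sum_const, Finset.card_univ, nsmul_eq_mul,
    nsmul_eq_mul, mul_one] at hsum
  refine le_trans ?_ hsum
  rw [mul_comm]
  gcongr
  nlinarith

theorem six_mul_sum_hammingDist_ge_of_four_le {n : ℕ} (hn : 4 ≤ n) {M : Type*} [Fintype M]
    (hM : (Fintype.card M : ℝ) ^ 2 ≤ (n : ℝ) ^ n)
    (enc : (Fin n → Fin n) → M) (dec : M → (Fin n → Fin n)) :
    (n : ℝ) * (n : ℝ) ^ n ≤ 6 * ∑ f, (hammingDist (dec (enc f)) f : ℝ) := by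
  by_contra! hlt
  have hn4 : (4 : ℝ) ≤ n := by exact_mod_cast hn
  have hn0 : (0 : ℝ) < n := by linarith
  have ht : (0 : ℝ) < 1 / (5 * n) := by positivity
  set u : ℝ := (1 / (5 * n : ℝ)) ^ ((6 : ℕ) : ℝ)⁻¹ with hu_def
  have hu : 0 < u := Real.rpow_pos_of_pos ht _
  have hu6 : u ^ 6 = 1 / (5 * n) := Real.rpow_inv_natCast_pow ht.le (by norm_num)
  have hu1 : u ≤ 1 := by
    refine Real.rpow_le_one ht.le ?_ (by positivity)
    rw [div_le_one (by positivity)]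
    linarith
  have hcard : (Fintype.card (Fin n → Fin n) : ℝ) = (n : ℝ) ^ n := by simp
  have hlower := card_mul_pow_le_sum_pow (fun f => hammingDist (dec (enc f)) f) n hu hu1
    (by rw [hcard]; exact hlt.le)
  have hupper := sum_pow_hammingDist_decode_le enc dec (pow_pos hu 6).le
  rw [hcard] at hlower
  rw [Fintype.card_fin] at hupper
  have hbase : 1 + ((n : ℝ) - 1) * u ^ 6 ≤ 6 / 5 := by
    rw [hu6]
    have : (n : ℝ) * (1 / (5 * n)) = 1 / 5 := by field_simp
    linarith
  have hbase0 : 0 ≤ 1 + ((n : ℝ) - 1) * u ^ 6 := by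
    have : 0 ≤ ((n : ℝ) - 1) * u ^ 6 := mul_nonneg (by linarith) (by positivity)
    linarith
  have hmain : (n : ℝ) ^ n * u ^ n ≤ Fintype.card M * (6 / 5) ^ n := by
    refine (hlower.trans hupper).trans ?_
    gcongr
  have hsq : ((n : ℝ) ^ n * u ^ n) ^ 2 ≤ (n : ℝ) ^ n * ((6 / 5) ^ n) ^ 2 := by
    refine (pow_le_pow_left₀ (by positivity) hmain 2).trans ?_
    rw [mul_pow]
    gcongr
  have hpow : ((n : ℝ) * u ^ 2) ^ n ≤ (36 / 25) ^ n := by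
    have h1 : ((n : ℝ) ^ n * u ^ n) ^ 2 = (n : ℝ) ^ n * ((n : ℝ) * u ^ 2) ^ n := by
      rw [mul_pow (n : ℝ) (u ^ 2)]
      ring
    have h2 : (((6 : ℝ) / 5) ^ n) ^ 2 = (36 / 25) ^ n := by
      rw [← pow_mul, mul_comm, pow_mul]
      norm_num
    rw [h1, h2] at hsq
    exact le_of_mul_le_mul_left hsq (by positivity)
  have hroot : (n : ℝ) * u ^ 2 ≤ 36 / 25 :=
    le_of_pow_le_pow_left₀ (by omega) (by norm_num) hpow
  have hcube := pow_le_pow_left₀ (by positivity) hroot 3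
  have h5 : ((n : ℝ) * u ^ 2) ^ 3 = (n : ℝ) ^ 2 / 5 := by
    rw [mul_pow, ← pow_mul, hu6]
    field_simp
  rw [h5] at hcube
  norm_num at hcube
  nlinarith

theorem six_mul_sum_hammingDist_ge {n : ℕ} (hn : 2 ≤ n) {M : Type*} [Fintype M]
    (hM : (Fintype.card M : ℝ) ^ 2 ≤ (n : ℝ) ^ n)
    (enc : (Fin n → Fin n) → M) (dec : M → (Fin n → Fin n)) :
    (n : ℝ) * (n : ℝ) ^ n ≤ 6 * ∑ f, (hammingDist (dec (enc f)) f : ℝ) := by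
  rcases le_or_gt 4 n with h4 | h4
  · exact six_mul_sum_hammingDist_ge_of_four_le h4 hM enc dec
  · have h := card_sub_card_le_sum_hammingDist enc dec
    interval_cases n <;> norm_num at h hM ⊢ <;> nlinarith


/-- If a message space has at most `2 ^ ((n·log₂ n)/2)` elements, then any
encoding/decoding of a uniformly random function `f : Fin n → Fin n`,
evaluated at a uniformly random point `j`, errs with probability at least `1/6`. -/
theorem encoding_error_at_least_one_sixth
    (n : ℕ) (hn : 2 ≤ n)
    (M : Type*) [Fintype M]
    (hM : (Fintype.card M : ℝ) ≤ (2 : ℝ) ^ (((n : ℝ) * Real.logb 2 n) / 2))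
    (enc : (Fin n → Fin n) → M) (dec : M → (Fin n → Fin n)) :
    (1 : ℝ) / 6 ≤
      ((Finset.univ.filter fun q : (Fin n → Fin n) × Fin n =>
          dec (enc q.1) q.2 ≠ q.1 q.2).card : ℝ) /
        (Fintype.card ((Fin n → Fin n) × Fin n) : ℝ) := by
  have hn0 : (0 : ℝ) < n := by positivity
  have hM2 : (Fintype.card M : ℝ) ^ 2 ≤ (n : ℝ) ^ n := by
    refine (pow_le_pow_left₀ (by positivity) hM 2).trans_eq ?_
    rw [← Real.rpow_mul_natCast (by norm_num), Nat.cast_ofNat, div_mul_cancel₀ _ two_ne_zero,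
      mul_comm, Real.rpow_mul (by norm_num), Real.rpow_logb (by norm_num) (by norm_num) hn0,
      Real.rpow_natCast]
  have hcount : ((Finset.univ.filter fun q : (Fin n → Fin n) × Fin n =>
      dec (enc q.1) q.2 ≠ q.1 q.2).card : ℝ) = ∑ f, (hammingDist (dec (enc f)) f : ℝ) := by
    simp only [Finset.card_filter, Fintype.sum_prod_type, hammingDist]
    push_cast
    rfl
  have hcard : (Fintype.card ((Fin n → Fin n) × Fin n) : ℝ) = n * (n : ℝ) ^ n := by
    simp [mul_comm]
  have h := six_mul_sum_hammingDist_ge hn hM2 enc dec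
  rw [hcount, hcard, le_div_iff₀ (by positivity)]
  linarith
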